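/- For every dual-normal program P, the set UE(P) of all UE-models of P is UE-complete and splittable. -/

import Mathlib

open Classical

noncomputable section

/-- A rule of a disjunctive logic program: head, positive body, negative body. -/
structure Rule (A : Type*) where
  head : Finset A
  bodyP : Finset A
  bodyN : Finset A
  deriving DecidableEq

/-- A program is a finite set of rules. -/
abbrev Program (A : Type*) := Finset (Rule A)

variable {A : Type*} [DecidableEq A]

/-- The atoms occurring in a program. -/
def atoms (P : Program A) : Finset A := P.sup (fun r => r.head ∪ r.bodyP ∪ r.bodyN)

/-- An interpretation `I` satisfies a rule `r` iff `(H(r) ∪ B⁻(r)) ∩ I ≠ ∅` or `B⁺(r) \ I ≠ ∅`. -/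
def satR (I : Set A) (r : Rule A) : Prop :=
  (∃ a ∈ r.head ∪ r.bodyN, a ∈ I) ∨ (∃ a ∈ r.bodyP, a ∉ I)

/-- `I` is a model of `P` iff it satisfies every rule of `P`. -/
def isModel (I : Set A) (P : Program A) : Prop := ∀ r ∈ P, satR I r

/-- The Gelfond-Lifschitz reduct `P^I`. -/
def reduct (P : Program A) (I : Set A) : Program A :=
  (P.filter (fun r => ∀ a ∈ r.bodyN, a ∉ I)).image (fun r => ⟨r.head, r.bodyP, ∅⟩)

/-- `I` is an inclusion-minimal model of `P`. -/
def isMinModel (I : Set A) (P : Program A) : Prop :=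
  isModel I P ∧ ∀ J ⊆ I, isModel J P → J = I

/-- `I` is an answer set of `P` iff `I` is a minimal model of the reduct `P^I`. -/
def isAnswerSet (I : Set A) (P : Program A) : Prop := isMinModel I (reduct P I)

/-- The collection of answer sets of `P`. -/
def AS (P : Program A) : Set (Set A) := {M | isAnswerSet M P}

/-- Dual-Horn: every rule has at most one positive body atom and empty negative body. -/
def dualHorn (P : Program A) : Prop := ∀ r ∈ P, r.bodyP.card ≤ 1 ∧ r.bodyN = ∅

/-- Dual-normal: every rule is a constraint or has at most one positive body atom. -/
def dualNormal (P : Program A) : Prop := ∀ r ∈ P, r.head = ∅ ∨ r.bodyP.card ≤ 1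

/-- Normal: every rule has at most one head atom. -/
def normal (P : Program A) : Prop := ∀ r ∈ P, r.head.card ≤ 1

/-- The proper rules (non-constraints) of `P`. -/
def properPart (P : Program A) : Program A := P.filter (fun r => r.head ≠ ∅)

/-- The constraints of `P`. -/
def constraintPart (P : Program A) : Program A := P.filter (fun r => r.head = ∅)

/-- `P[t]`: replace each rule with empty positive body by one whose positive body is `{t}`. -/
def progT (P : Program A) (t : A) : Program A :=
  P.image (fun r => if r.bodyP = ∅ then ⟨r.head, {t}, r.bodyN⟩ else r)

/-- The elimination sets `E_i` computed from `P[t]` (for `P` dual-Horn). -/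
def E (P : Program A) (t : A) : ℕ → Set A
  | 0 => ∅
  | (i+1) => {b | ∃ r ∈ progT P t, r.bodyP = {b} ∧ ↑r.head ⊆ E P t i}

/-- The program `P_{M,m}`. -/
def pmm (P : Program A) (M : Set A) (m : A) : Program A :=
  reduct (properPart P) M ∪
    ((atoms P).filter (fun b => b ∉ M)).image (fun b => ⟨∅, {b}, ∅⟩) ∪
    {⟨∅, {m}, ∅⟩}

/-- `(X, Y)` is an SE-model of `P` iff `Y ⊨ P` and `X ⊨ P^Y`
(SE-interpretations additionally require `X ⊆ Y`). -/
def isSEModel (P : Program A) (X Y : Set A) : Prop :=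
  isModel Y P ∧ isModel X (reduct P Y)

/-- The set of all SE-models of `P` (as SE-interpretations, i.e. with `X ⊆ Y`). -/
def SEset (P : Program A) : Set (Set A × Set A) :=
  {p | p.1 ⊆ p.2 ∧ isSEModel P p.1 p.2}

/-- `(X, Y)` is a UE-model of `P`: an SE-model such that every SE-model `(X', Y)` with
`X ⊊ X'` satisfies `X' = Y`. -/
def isUEModel (P : Program A) (X Y : Set A) : Prop :=
  isSEModel P X Y ∧ ∀ X' : Set A, X' ⊆ Y → isSEModel P X' Y → X ⊂ X' → X' = Y

/-- The set of all UE-models of `P` (as SE-interpretations, i.e. with `X ⊆ Y`). -/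
def UEset (P : Program A) : Set (Set A × Set A) :=
  {p | p.1 ⊆ p.2 ∧ isUEModel P p.1 p.2}

/-- A set of SE-interpretations is complete. -/
def completeSE {B : Type*} (S : Set (Set B × Set B)) : Prop :=
  (∀ X Y : Set B, (X, Y) ∈ S → (Y, Y) ∈ S) ∧
  (∀ X Y Z : Set B, (X, Y) ∈ S → (Z, Z) ∈ S → Y ⊆ Z → (X, Z) ∈ S)

/-- A set of SE-interpretations is closed under here-union. -/
def closedHereUnion {B : Type*} (S : Set (Set B × Set B)) : Prop :=
  ∀ X X' Y : Set B, (X, Y) ∈ S → (X', Y) ∈ S → (X ∪ X', Y) ∈ S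

/-- A set of SE-interpretations is UE-complete. -/
def UEComplete {B : Type*} (S : Set (Set B × Set B)) : Prop :=
  (∀ X Y : Set B, (X, Y) ∈ S → (Y, Y) ∈ S) ∧
  (∀ X Y Z : Set B, (X, Y) ∈ S → (Z, Z) ∈ S → Y ⊂ Z →
    ∃ Y' : Set B, Y ⊆ Y' ∧ Y' ⊂ Z ∧ (Y', Z) ∈ S) ∧
  (∀ X X' Y : Set B, (X, Y) ∈ S → (X', Y) ∈ S → X ⊂ X' → X' = Y)

/-- A set of SE-interpretations is splittable: for every `(Z,Z) ∈ S` and every finite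
nonempty family `(X₁,Y₁), …, (X_k,Y_k) ∈ S` with all `Yᵢ ⊆ Z`, either
`(X₁ ∪ ⋯ ∪ X_k, Z) ∈ S` or `(Z', Z) ∈ S` for some `Z'` with
`X₁ ∪ ⋯ ∪ X_k ⊆ Z' ⊊ Z`. -/
def splittable {B : Type*} (S : Set (Set B × Set B)) : Prop :=
  ∀ Z : Set B, (Z, Z) ∈ S →
    ∀ (n : ℕ) (p : Fin (n + 1) → Set B × Set B),
      (∀ i, p i ∈ S) → (∀ i, (p i).2 ⊆ Z) →
      ((⋃ i, (p i).1), Z) ∈ S ∨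
        ∃ Z' : Set B, (⋃ i, (p i).1) ⊆ Z' ∧ Z' ⊂ Z ∧ (Z', Z) ∈ S

theorem isModel_reduct_iff (P : Program A) (X Y : Set A) :
    isModel X (reduct P Y) ↔
      ∀ r ∈ P, (∀ a ∈ r.bodyN, a ∉ Y) → (∃ a ∈ r.head, a ∈ X) ∨ (∃ a ∈ r.bodyP, a ∉ X) := by
  unfold isModel reduct
  constructor
  · intro h r hr hn
    have := h ⟨r.head, r.bodyP, ∅⟩
      (Finset.mem_image.2 ⟨r, Finset.mem_filter.2 ⟨hr, hn⟩, rfl⟩)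
    simpa [satR] using this
  · intro h r hr
    obtain ⟨q, hq, rfl⟩ := Finset.mem_image.1 hr
    obtain ⟨hq, hn⟩ := Finset.mem_filter.1 hq
    simpa [satR] using h q hq hn

/-- A model of `P` below `Z` is a model of the reduct with respect to `Z`. -/
theorem isModel_reduct_of_subset (P : Program A) {Y Z : Set A} (h : isModel Y P)
    (hYZ : Y ⊆ Z) : isModel Y (reduct P Z) := by
  rw [isModel_reduct_iff]
  intro r hr hn
  rcases h r hr with ⟨a, ha, haY⟩ | h
  · rcases Finset.mem_union.1 ha with ha | ha
    · exact Or.inl ⟨a, ha, haY⟩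
    · exact absurd (hYZ haY) (hn a ha)
  · exact Or.inr h

theorem mem_UEset_self (P : Program A) {Y : Set A} (h : isModel Y P) : (Y, Y) ∈ UEset P :=
  ⟨subset_rfl, ⟨h, isModel_reduct_of_subset P h subset_rfl⟩,
    fun _ h1 _ h2 => absurd h1 h2.2⟩

/-- Every SE-model `(X, Z)` with `X ⊂ Z` extends to a UE-model. -/
theorem exists_UE_extension [Fintype A] (P : Program A) {X Z : Set A} (hXZ : X ⊂ Z)
    (h : isSEModel P X Z) : ∃ Z' : Set A, X ⊆ Z' ∧ Z' ⊂ Z ∧ (Z', Z) ∈ UEset P := by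
  obtain ⟨M, hXM, hM⟩ := (Set.toFinite {W : Set A | W ⊂ Z ∧ isSEModel P W Z}).exists_le_maximal
    (show X ∈ {W : Set A | W ⊂ Z ∧ isSEModel P W Z} from ⟨hXZ, h⟩)
  refine ⟨M, hXM, hM.prop.1, hM.prop.1.subset, hM.prop.2, ?_⟩
  intro X' hX' hSE hlt
  by_contra hne
  exact hlt.2 (hM.2 ⟨hX'.ssubset_of_ne hne, hSE⟩ hlt.1)

/-- For every dual-normal program `P` (over a finite propositional
signature), the set of UE-models of `P` is UE-complete and splittable. -/
theorem dualNormal_UEset_UEComplete_splittable [Fintype A] (P : Program A)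
    (hP : dualNormal P) :
    UEComplete (UEset P) ∧ splittable (UEset P) := by
  refine ⟨⟨?_, ?_, ?_⟩, ?_⟩
  · intro X Y h
    exact mem_UEset_self P h.2.1.1
  · intro X Y Z hXY hZ hYZ
    exact exists_UE_extension P hYZ
      ⟨hZ.2.1.1, isModel_reduct_of_subset P hXY.2.1.1 hYZ.subset⟩
  · intro X X' Y h h' hlt
    exact h.2.2 X' h'.1 h'.2.1 hlt
  · intro Z hZ n p hp hpZ
    have hsub : (⋃ i, (p i).1) ⊆ Z := Set.iUnion_subset fun i => (hp i).1.trans (hpZ i)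
    have hmod : ∀ i, ∀ r ∈ P, (∀ a ∈ r.bodyN, a ∉ Z) →
        (∃ a ∈ r.head, a ∈ (p i).1) ∨ (∃ a ∈ r.bodyP, a ∉ (p i).1) := by
      intro i r hr hn
      exact (isModel_reduct_iff P _ _).1 (hp i).2.1.2 r hr (fun a ha hY => hn a ha (hpZ i hY))
    have hSE : isSEModel P (⋃ i, (p i).1) Z := by
      refine ⟨hZ.2.1.1, ?_⟩
      rw [isModel_reduct_iff]
      intro r hr hn
      by_contra hcon
      push Not at hcon
      obtain ⟨hh, hb⟩ := hcon
      have hh' : ∀ i, ∀ a ∈ r.head, a ∉ (p i).1 :=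
        fun i a ha hm => hh a ha (Set.mem_iUnion.2 ⟨i, hm⟩)
      have hmiss : ∀ i, ∃ a ∈ r.bodyP, a ∉ (p i).1 := by
        intro i
        rcases hmod i r hr hn with ⟨a, ha, hm⟩ | h
        · exact absurd hm (hh' i a ha)
        · exact h
      rcases hP r hr with hc | hc
      · rcases (isModel_reduct_iff P _ _).1 hZ.2.1.2 r hr hn with ⟨a, ha, _⟩ | ⟨a, ha, hm⟩
        · simp [hc] at ha
        · exact hm (hsub (hb a ha))
      · obtain ⟨a, ha, _⟩ := hmiss 0
        obtain ⟨i, hi⟩ := Set.mem_iUnion.1 (hb a ha)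
        obtain ⟨b, hb', hbm⟩ := hmiss i
        rw [Finset.card_le_one.1 hc b hb' a ha] at hbm
        exact hbm hi
    by_cases heq : (⋃ i, (p i).1) = Z
    · left
      rw [heq]
      exact hZ
    · right
      exact exists_UE_extension P (hsub.ssubset_of_ne heq) hSE
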